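/- arXiv:2603.18944 — 2 statements merged into one kernel-verified Lean document; each statement's English description precedes it below -/
import Mathlib

section
/- FEM resolvent lower bound (Lemma 5.2). Let τ > 0, h > 0 and C > 0. Let u : ℝ → ℝ be twice continuously differentiable on [0,1] with u(0) = u(1) = 0, and suppose u satisfies the inverse inequalities ∫₀¹ u'(x)² dx ≤ C²·h⁻²·∫₀¹ u(x)² dx and ∫₀¹ u''(x)² dx ≤ C²·h⁻⁴·∫₀¹ u(x)² dx. Define v(x) = −τ·u''(x) + u(x). Then ∫₀¹ u(x)² dx ≥ (1 + 2C²τh⁻² + C²h⁻⁴τ²)⁻¹ · ∫₀¹ v(x)² dx. -/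
open MeasureTheory intervalIntegral

/-- FEM resolvent lower bound (Lemma 5.2). -/
theorem fem_resolvent_lower_bound
    (τ h C : ℝ) (hτ : 0 < τ) (hh : 0 < h) (hC : 0 < C)
    (u : ℝ → ℝ) (hu : ContDiffOn ℝ 2 u (Set.Icc 0 1))
    (hu0 : u 0 = 0) (hu1 : u 1 = 0)
    (hinv1 : ∫ x in (0:ℝ)..1, (deriv u x) ^ 2 ≤
      C ^ 2 * h⁻¹ ^ 2 * ∫ x in (0:ℝ)..1, (u x) ^ 2)
    (hinv2 : ∫ x in (0:ℝ)..1, (deriv (deriv u) x) ^ 2 ≤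
      C ^ 2 * h⁻¹ ^ 4 * ∫ x in (0:ℝ)..1, (u x) ^ 2)
    (v : ℝ → ℝ) (hv : ∀ x, v x = -τ * deriv (deriv u) x + u x) :
    (1 + 2 * C ^ 2 * τ * h⁻¹ ^ 2 + C ^ 2 * h⁻¹ ^ 4 * τ ^ 2)⁻¹ *
        ∫ x in (0:ℝ)..1, (v x) ^ 2 ≤
      ∫ x in (0:ℝ)..1, (u x) ^ 2 := by
  have hI : UniqueDiffOn ℝ (Set.Icc (0:ℝ) 1) := uniqueDiffOn_Icc one_pos
  have huI : Set.uIcc (0:ℝ) 1 = Set.Icc 0 1 := Set.uIcc_of_le zero_le_one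
  obtain ⟨g, hg⟩ : ∃ g, g = derivWithin u (Set.Icc 0 1) := ⟨_, rfl⟩
  obtain ⟨k, hk⟩ : ∃ k, k = derivWithin g (Set.Icc 0 1) := ⟨_, rfl⟩
  have hgC : ContDiffOn ℝ 1 g (Set.Icc 0 1) := by
    rw [hg]; exact hu.derivWithin hI (by norm_num)
  have hkc : ContinuousOn k (Set.Icc 0 1) := by
    rw [hk]; exact hgC.continuousOn_derivWithin hI le_rfl
  have hgc := hgC.continuousOn
  have huc := hu.continuousOn
  have hud : ∀ x ∈ Set.uIcc (0:ℝ) 1, HasDerivWithinAt u (g x) (Set.uIcc (0:ℝ) 1) x := by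
    rw [huI, hg]
    intro x hx
    exact (hu.differentiableOn (by norm_num) x hx).hasDerivWithinAt
  have hgd : ∀ x ∈ Set.uIcc (0:ℝ) 1, HasDerivWithinAt g (k x) (Set.uIcc (0:ℝ) 1) x := by
    rw [huI, hk]
    intro x hx
    exact (hgC.differentiableOn (by norm_num) x hx).hasDerivWithinAt
  rw [← huI] at hkc hgc huc
  have hparts := integral_mul_deriv_eq_deriv_mul_of_hasDerivWithinAt hud hgd
    hgc.intervalIntegrable hkc.intervalIntegrable
  rw [hu0, hu1] at hparts
  have e1 : Set.EqOn (deriv u) g (Set.Ioo 0 1) := by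
    intro x hx
    have := hud x (huI ▸ Set.Ioo_subset_Icc_self hx)
    rw [huI] at this
    exact (this.hasDerivAt (Icc_mem_nhds hx.1 hx.2)).deriv
  have e2 : Set.EqOn (deriv (deriv u)) k (Set.Ioo 0 1) := by
    intro x hx
    have := hgd x (huI ▸ Set.Ioo_subset_Icc_self hx)
    rw [huI] at this
    rw [(e1.eventuallyEq_of_mem (Ioo_mem_nhds hx.1 hx.2)).deriv_eq]
    exact (this.hasDerivAt (Icc_mem_nhds hx.1 hx.2)).deriv
  have i1 : ∫ x in (0:ℝ)..1, (deriv u x) ^ 2 = ∫ x in (0:ℝ)..1, g x * g x :=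
    integral_congr_Ioo_of_le zero_le_one fun x hx => by
      simp only [e1 hx]; ring
  have i2 : ∫ x in (0:ℝ)..1, (deriv (deriv u) x) ^ 2 = ∫ x in (0:ℝ)..1, (k x) ^ 2 :=
    integral_congr_Ioo_of_le zero_le_one fun x hx => by
      simp only [e2 hx]
  have i3 : ∫ x in (0:ℝ)..1, (v x) ^ 2 =
      ∫ x in (0:ℝ)..1, (τ ^ 2 * (k x) ^ 2 - 2 * τ * (u x * k x) + (u x) ^ 2) :=
    integral_congr_Ioo_of_le zero_le_one fun x hx => by
      simp only [hv, e2 hx]; ring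
  have n1 : IntervalIntegrable (fun x => τ ^ 2 * (k x) ^ 2) volume 0 1 :=
    (continuousOn_const.mul (hkc.pow 2)).intervalIntegrable
  have n2 : IntervalIntegrable (fun x => 2 * τ * (u x * k x)) volume 0 1 :=
    (continuousOn_const.mul (huc.mul hkc)).intervalIntegrable
  have n3 : IntervalIntegrable (fun x => (u x) ^ 2) volume 0 1 :=
    (huc.pow 2).intervalIntegrable
  rw [integral_add (n1.sub n2) n3, integral_sub n1 n2, intervalIntegral.integral_const_mul,
    intervalIntegral.integral_const_mul, hparts] at i3
  rw [i1] at hinv1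
  rw [i2] at hinv2
  rw [i3, inv_mul_le_iff₀ (by positivity)]
  have a1 := mul_le_mul_of_nonneg_left hinv1 (by positivity : 0 ≤ 2 * τ)
  have a2 := mul_le_mul_of_nonneg_left hinv2 (by positivity : 0 ≤ τ ^ 2)
  linarith
end

section
/- One-step energy estimate for the gradient-tamed scheme (estimate (7.13) in the proof of Proposition 7.2). Let H be a real inner product space with inner product ⟨·,·⟩ and norm ‖·‖, let V ⊆ H be a linear subspace, and let B : V × V → ℝ be a bilinear form with B(ψ,ψ) ≥ 0 for all ψ ∈ V. Let τ > 0, α > 0, c > 0, b₁ ≥ 0, let u⁰, u¹, w ∈ V, g ∈ H and ν ∈ ℝ with ν ≥ c·‖g‖ and ⟨g, u⁰⟩ ≤ b₁, and suppose that for every ψ ∈ V, ⟨u¹, ψ⟩ = ⟨u⁰, ψ⟩ − τ·B(u¹, ψ) + (τ/(1 + ατν²))·⟨g, ψ⟩ + ⟨w, ψ⟩. Then ‖u¹‖² + 2τ·B(u¹, u¹) + (1/2)·‖u¹ − u⁰‖² ≤ ‖u⁰‖² + 2⟨w, u⁰⟩ + (2b₁ + 1/(αc²))·τ + 4‖w‖².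 -/
open scoped RealInnerProductSpace

/-- One-step energy estimate for the gradient-tamed scheme
(estimate (7.13) in the proof of Proposition 7.2). -/
theorem tamed_scheme_one_step_energy_estimate
    {H : Type*} [NormedAddCommGroup H] [InnerProductSpace ℝ H]
    (V : Submodule ℝ H)
    (B : V →ₗ[ℝ] V →ₗ[ℝ] ℝ) (hB : ∀ ψ : V, 0 ≤ B ψ ψ)
    (τ α c b₁ : ℝ) (hτ : 0 < τ) (hα : 0 < α) (hc : 0 < c) (hb₁ : 0 ≤ b₁)
    (u₀ u₁ w : V) (g : H) (ν : ℝ)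
    (hν : c * ‖g‖ ≤ ν)
    (hg : ⟪g, (u₀ : H)⟫ ≤ b₁)
    (heq : ∀ ψ : V, ⟪(u₁ : H), (ψ : H)⟫ =
      ⟪(u₀ : H), (ψ : H)⟫ - τ * B u₁ ψ + (τ / (1 + α * τ * ν ^ 2)) * ⟪g, (ψ : H)⟫ +
        ⟪(w : H), (ψ : H)⟫) :
    ‖(u₁ : H)‖ ^ 2 + 2 * τ * B u₁ u₁ + (1 / 2) * ‖(u₁ : H) - (u₀ : H)‖ ^ 2 ≤
      ‖(u₀ : H)‖ ^ 2 + 2 * ⟪(w : H), (u₀ : H)⟫ + (2 * b₁ + 1 / (α * c ^ 2)) * τ +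
        4 * ‖(w : H)‖ ^ 2 := by
  have hE := heq u₁
  obtain ⟨d, hd⟩ : ∃ d : H, d = (u₁ : H) - (u₀ : H) := ⟨_, rfl⟩
  have hu : (u₁ : H) = (u₀ : H) + d := by rw [hd]; abel
  have hD1 : 1 ≤ 1 + α * τ * ν ^ 2 := by
    have : 0 ≤ α * τ * ν ^ 2 := by positivity
    linarith
  obtain ⟨D, hD⟩ : ∃ D : ℝ, D = 1 + α * τ * ν ^ 2 := ⟨_, rfl⟩
  rw [← hD] at hE hD1
  have hD0 : 0 < D := by linarith
  obtain ⟨s, hs⟩ : ∃ s : ℝ, s = τ / D := ⟨_, rfl⟩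
  rw [← hs] at hE
  have hsD : s * D = τ := by rw [hs]; field_simp
  have hs0 : 0 ≤ s := by rw [hs]; positivity
  have hsτ : s ≤ τ := by rw [hs]; exact div_le_self hτ.le hD1
  have hG : (c * ‖g‖) ^ 2 ≤ ν ^ 2 := pow_le_pow_left₀ (by positivity) hν 2
  have hDsq : 4 * (α * τ * (c * ‖g‖) ^ 2) ≤ D ^ 2 := by
    have h1 : α * τ * (c * ‖g‖) ^ 2 ≤ α * τ * ν ^ 2 :=
      mul_le_mul_of_nonneg_left hG (by positivity)
    rw [hD]
    nlinarith [sq_nonneg (1 - α * τ * ν ^ 2)]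
  have key : 4 * (s * ‖g‖) ^ 2 ≤ 1 / (α * c ^ 2) * τ := by
    rw [one_div, inv_mul_eq_div, le_div_iff₀ (by positivity)]
    have h2 := mul_le_mul_of_nonneg_left hDsq (sq_nonneg s)
    have h3 : s ^ 2 * D ^ 2 = τ * τ := by rw [← mul_pow, hsD, sq]
    rw [h3] at h2
    refine le_of_mul_le_mul_left ?_ hτ
    linarith
  have hg0 : s * ⟪g, (u₀ : H)⟫ ≤ τ * b₁ :=
    (mul_le_mul_of_nonneg_left hg hs0).trans (mul_le_mul_of_nonneg_right hsτ hb₁)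
  have hgd : s * ⟪g, d⟫ ≤ s * (‖g‖ * ‖d‖) :=
    mul_le_mul_of_nonneg_left (real_inner_le_norm g d) hs0
  have hwd := real_inner_le_norm (w : H) d
  have y1 := sq_nonneg (2 * (s * ‖g‖) - ‖d‖ / 2)
  have y2 := sq_nonneg (2 * ‖(w : H)‖ - ‖d‖ / 2)
  have hn : ‖(u₁ : H)‖ ^ 2 = ‖(u₀ : H)‖ ^ 2 + 2 * ⟪(u₀ : H), d⟫ + ‖d‖ ^ 2 := by
    rw [hu]; exact norm_add_sq_real _ _
  rw [real_inner_self_eq_norm_sq] at hE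
  have e0 : ⟪(u₀ : H), (u₁ : H)⟫ = ‖(u₀ : H)‖ ^ 2 + ⟪(u₀ : H), d⟫ := by
    rw [hu, inner_add_right, real_inner_self_eq_norm_sq]
  have e1 : ⟪g, (u₁ : H)⟫ = ⟪g, (u₀ : H)⟫ + ⟪g, d⟫ := by rw [hu, inner_add_right]
  have e2 : ⟪(w : H), (u₁ : H)⟫ = ⟪(w : H), (u₀ : H)⟫ + ⟪(w : H), d⟫ := by
    rw [hu, inner_add_right]
  rw [e0, e1, e2] at hE
  rw [← hd]
  nlinarith
end
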